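/- arXiv:math/0401239 — 4 statements merged into one kernel-verified Lean document; each statement's English description precedes it below -/
import Mathlib

section
/- Let 𝐁 be a (v,k,λ)-short difference family in a finite group (G,+). Then the development dev 𝐁 = {B+g | B ∈ 𝐁, g ∈ G} is a (v,k,λ)-BIB-design on the point set G. -/
open Pointwise

variable {G : Type*}

/-- The stabilizer `G_B = {g ∈ G | B + g = B}` of a subset `B` under the action of `G`
on itself by right translation. -/
def rtStab [Add G] (B : Set G) : Set G := {g : G | (fun x => x + g) '' B = B}

/-- The development `dev Bs = {B + g | B ∈ Bs, g ∈ G}` of a family of subsets of `G`. -/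
def dev [Add G] (Bs : Set (Set G)) : Set (Set G) :=
  {C : Set G | ∃ B ∈ Bs, ∃ g : G, C = (fun x => x + g) '' B}

/-- `Bs` is a `(v, k, λ'/(μν))`-short difference family in the group `(G,+)`:
there are positive integers `k, μ, ν, λ'` such that every `B ∈ Bs` has size `k`,
stabilizer of size `μ`, a `∼`-equivalence class (where `B ∼ C` iff `B` is a translate
of `C`) of size `ν`, and every `d ≠ 0` is realized as a difference `a - b` with
`a, b ∈ B ∈ Bs` in exactly `λ'` ways. -/
def IsSDF [AddGroup G] (Bs : Set (Set G)) (v k : ℕ) (lam : ℚ) : Prop :=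
  Nat.card G = v ∧ 1 < v ∧ 0 < k ∧
  (∀ B ∈ Bs, Nat.card B = k) ∧
  ∃ μ ν lam' : ℕ, 0 < μ ∧ 0 < ν ∧ 0 < lam' ∧
    lam = (lam' : ℚ) / ((μ : ℚ) * (ν : ℚ)) ∧
    (∀ B ∈ Bs, Nat.card (rtStab B) = μ) ∧
    (∀ B ∈ Bs, Nat.card {C : Set G | C ∈ Bs ∧ ∃ g : G, B = (fun x => x + g) '' C} = ν) ∧
    (∀ d : G, d ≠ 0 →
      Nat.card {t : Set G × G × G | t.1 ∈ Bs ∧ t.2.1 ∈ t.1 ∧ t.2.2 ∈ t.1 ∧ t.2.1 - t.2.2 = d}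
        = lam')

/-- `Bs` is a `(v, k, λ)`-BIB-design on the point set `V`: `|V| = v > 1`, every block has
size `k`, and every pair of distinct points lies in exactly `λ` blocks. -/
def IsDesign {V : Type*} (Bs : Set (Set V)) (v k lam : ℕ) : Prop :=
  Nat.card V = v ∧ 1 < v ∧
  (∀ B ∈ Bs, Nat.card B = k) ∧
  (∀ u w : V, u ≠ w → Nat.card {B : Set V | B ∈ Bs ∧ u ∈ B ∧ w ∈ B} = lam)

theorem Nat.card_eq_mul_of_card_fiber_eq {α β : Type*} [Finite α] [Finite β] (f : α → β) (n : ℕ)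
    (hf : ∀ b, Nat.card {a // f a = b} = n) : Nat.card α = Nat.card β * n := by
  have := Fintype.ofFinite β
  rw [← Nat.card_congr (Equiv.sigmaFiberEquiv f), Nat.card_sigma]
  simp [hf]

theorem image_add_right_image_add_right [AddGroup G] (B : Set G) (g h : G) :
    (fun x => x + h) '' ((fun x => x + g) '' B) = (fun x => x + (g + h)) '' B := by
  simp only [Set.image_image, add_assoc]

theorem image_add_right_eq_iff [AddGroup G] (B C : Set G) (g : G) :
    (fun x => x + g) '' B = C ↔ B = (fun x => x + -g) '' C := by
  constructor
  · rintro rfl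
    simp only [Set.image_image, add_neg_cancel_right, Set.image_id']
  · rintro rfl
    simp only [Set.image_image, neg_add_cancel_right, Set.image_id']

/-- The elements translating `B` to a fixed translate `B + g` form a coset of the stabilizer. -/
theorem card_translators_eq_card_rtStab [AddGroup G] (B : Set G) (g : G) :
    Nat.card {h : G // (fun x => x + h) '' B = (fun x => x + g) '' B} = Nat.card (rtStab B) := by
  refine Nat.card_congr ((Equiv.addRight (-g)).subtypeEquiv fun h => ?_)
  change _ ↔ (fun x => x + (h + -g)) '' B = B
  rw [← image_add_right_image_add_right, eq_comm, image_add_right_eq_iff, eq_comm]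

/-- Every block `C` of the development arises from exactly `ν * μ` pairs `(B, g)`. -/
theorem card_pairs_translating_to [AddGroup G] [Finite G] {Bs : Set (Set G)} {μ ν : ℕ}
    (hμ : ∀ B ∈ Bs, Nat.card (rtStab B) = μ)
    (hν : ∀ B ∈ Bs,
      Nat.card {C : Set G | C ∈ Bs ∧ ∃ g : G, B = (fun x => x + g) '' C} = ν)
    {C : Set G} (hC : C ∈ dev Bs) :
    Nat.card {p : Set G × G // p.1 ∈ Bs ∧ C = (fun x => x + p.2) '' p.1} = ν * μ := by
  obtain ⟨B₀, hB₀, g₀, rfl⟩ := hC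
  have hclass : {D : Set G | D ∈ Bs ∧ ∃ g : G, B₀ = (fun x => x + g) '' D} =
      {D : Set G | D ∈ Bs ∧ ∃ g : G, (fun x => x + g₀) '' B₀ = (fun x => x + g) '' D} := by
    ext D
    refine and_congr_right fun _ => ⟨?_, ?_⟩
    · rintro ⟨g, rfl⟩
      exact ⟨g + g₀, image_add_right_image_add_right D g g₀⟩
    · rintro ⟨g, hg⟩
      refine ⟨g + -g₀, ?_⟩
      rw [← image_add_right_image_add_right, ← image_add_right_eq_iff, hg]
  rw [← hν B₀ hB₀, hclass]
  refine Nat.card_eq_mul_of_card_fiber_eq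
    (fun p => ⟨p.1.1, p.2.1, p.1.2, p.2.2⟩) μ ?_
  rintro ⟨D, hD, g, hg⟩
  rw [← hμ D hD, ← card_translators_eq_card_rtStab D g]
  exact Nat.card_congr
    { toFun := fun p => ⟨p.1.1.2, by
        obtain ⟨⟨⟨E, h⟩, hE, hh⟩, hp⟩ := p
        obtain rfl : E = D := congrArg Subtype.val hp
        exact hh.symm.trans hg⟩
      invFun := fun h => ⟨⟨(D, h.1), hD, hg.trans h.2.symm⟩, rfl⟩
      left_inv := by
        rintro ⟨⟨⟨E, h⟩, hE, hh⟩, hp⟩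
        obtain rfl : E = D := congrArg Subtype.val hp
        rfl
      right_inv := fun _ => rfl }

/-- Pairs `(B, g)` with `u, w ∈ B + g` correspond to representations of `u - w` as a difference. -/
def pairsEquivDifferences [AddGroup G] (Bs : Set (Set G)) (u w : G) :
    {p : Set G × G // p.1 ∈ Bs ∧ u ∈ (fun x => x + p.2) '' p.1 ∧ w ∈ (fun x => x + p.2) '' p.1} ≃
    {t : Set G × G × G |
      t.1 ∈ Bs ∧ t.2.1 ∈ t.1 ∧ t.2.2 ∈ t.1 ∧ t.2.1 - t.2.2 = u - w} where
  toFun p := ⟨(p.1.1, u + -p.1.2, w + -p.1.2), p.2.1, by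
    simpa using p.2.2.1, by simpa using p.2.2.2, by simp [sub_eq_add_neg, add_assoc]⟩
  invFun t := ⟨(t.1.1, -t.1.2.1 + u), t.2.1, ⟨t.1.2.1, t.2.2.1, by simp⟩,
    ⟨t.1.2.2, t.2.2.2.1, by
      have h : t.1.2.1 - t.1.2.2 = u - w := t.2.2.2.2
      have h' := congrArg Neg.neg h
      rw [neg_sub, neg_sub] at h'
      change t.1.2.2 + (-t.1.2.1 + u) = w
      rw [← add_assoc, ← sub_eq_add_neg, h', sub_add_cancel]⟩⟩
  left_inv p := by
    ext1
    simp [add_assoc]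
  right_inv t := by
    have h : t.1.2.1 - t.1.2.2 = u - w := t.2.2.2.2
    have h' := congrArg Neg.neg h
    rw [neg_sub, neg_sub] at h'
    ext1
    refine Prod.ext rfl (Prod.ext ?_ ?_)
    · simp
    · change w + -(-t.1.2.1 + u) = t.1.2.2
      rw [neg_add_rev, neg_neg, ← add_assoc, ← sub_eq_add_neg, ← h', sub_add_cancel]

/-- Proposition 2: if `Bs` is a `(v,k,λ)`-short difference family in the finite group `G`,
then `dev Bs` is a `(v,k,λ)`-BIB-design on `G`. -/
theorem sdf_dev_isDesign [AddGroup G] [Finite G] (Bs : Set (Set G)) (v k lam : ℕ)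
    (h : IsSDF Bs v k (lam : ℚ)) : IsDesign (dev Bs) v k lam := by
  obtain ⟨hv, hv1, -, hk, μ, ν, lam', hμ0, hν0, -, hlam, hμ, hν, hd⟩ := h
  refine ⟨hv, hv1, ?_, fun u w huw => ?_⟩
  · rintro _ ⟨B, hB, g, rfl⟩
    rw [Nat.card_image_of_injective (add_left_injective g)]
    exact hk B hB
  · have hcount : lam' = Nat.card {B : Set G | B ∈ dev Bs ∧ u ∈ B ∧ w ∈ B} * (ν * μ) := by
      rw [← hd (u - w) (sub_ne_zero.mpr huw), ← Nat.card_congr (pairsEquivDifferences Bs u w)]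
      refine Nat.card_eq_mul_of_card_fiber_eq
        (fun p => ⟨(fun x => x + p.1.2) '' p.1.1, ⟨p.1.1, p.2.1, p.1.2, rfl⟩, p.2.2⟩) _ ?_
      rintro ⟨C, hC, hu, hw⟩
      rw [← card_pairs_translating_to hμ hν hC]
      exact Nat.card_congr
        { toFun := fun p => ⟨p.1.1, p.1.2.1, (congrArg Subtype.val p.2).symm⟩
          invFun := fun p => ⟨⟨p.1, p.2.1, p.2.2 ▸ hu, p.2.2 ▸ hw⟩, Subtype.ext p.2.2.symm⟩
          left_inv := fun _ => rfl
          right_inv := fun _ => rfl }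
    have hμ' : (μ : ℚ) ≠ 0 := by positivity
    have hν' : (ν : ℚ) ≠ 0 := by positivity
    rw [eq_div_iff (mul_ne_zero hμ' hν'), hcount] at hlam
    norm_cast at hlam
    rw [mul_comm ν μ] at hlam
    exact (Nat.eq_of_mul_eq_mul_right (Nat.mul_pos hμ0 hν0) hlam).symm
end

section
/- Let F be a finite field and let S ⊆ F with |S| > 1. Then 𝐁 = {S·x | x ∈ F*} is a short difference family in the additive group (F,+), where S·x = {s·x | s ∈ S}. -/
open Pointwise

variable {G : Type*}

theorem image_add_right_image {G : Type*} [Add G] (f : G ≃+ G) (B : Set G) (g : G) :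
    (fun x => x + f g) '' (f '' B) = f '' ((fun x => x + g) '' B) := by
  simp only [Set.image_image, map_add]

/-- Additive automorphisms preserve the size of translation stabilizers. -/
theorem card_rtStab_image {G : Type*} [Add G] (f : G ≃+ G) (B : Set G) :
    Nat.card (rtStab (f '' B)) = Nat.card (rtStab B) := by
  refine (Nat.card_congr (f.toEquiv.subtypeEquiv fun g => ?_)).symm
  change (fun x => x + g) '' B = B ↔ (fun x => x + f g) '' (f '' B) = f '' B
  rw [image_add_right_image, f.injective.image_injective.eq_iff]

/-- Additive automorphisms preserving a family preserve the size of its translation classes. -/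
theorem card_translationClass_image {G : Type*} [Add G] (f : G ≃+ G) (Bs : Set (Set G))
    (hf : ∀ C, f '' C ∈ Bs ↔ C ∈ Bs) (B : Set G) :
    Nat.card {C : Set G | C ∈ Bs ∧ ∃ g : G, f '' B = (fun x => x + g) '' C} =
      Nat.card {C : Set G | C ∈ Bs ∧ ∃ g : G, B = (fun x => x + g) '' C} := by
  refine (Nat.card_congr ((Equiv.Set.congr f.toEquiv).subtypeEquiv fun C => ?_)).symm
  change (C ∈ Bs ∧ ∃ g : G, B = (fun x => x + g) '' C) ↔
    (f '' C ∈ Bs ∧ ∃ g : G, f '' B = (fun x => x + g) '' (f '' C))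
  rw [hf]
  refine and_congr_right fun _ => (Iff.trans f.surjective.exists ?_).symm
  simp only [image_add_right_image, f.injective.image_injective.eq_iff]

/-- Additive automorphisms preserving a family permute its difference counts. -/
theorem card_differences_map {G : Type*} [AddGroup G] (f : G ≃+ G) (Bs : Set (Set G))
    (hf : ∀ C, f '' C ∈ Bs ↔ C ∈ Bs) (d : G) :
    Nat.card {t : Set G × G × G |
        t.1 ∈ Bs ∧ t.2.1 ∈ t.1 ∧ t.2.2 ∈ t.1 ∧ t.2.1 - t.2.2 = f d} =
      Nat.card {t : Set G × G × G |
        t.1 ∈ Bs ∧ t.2.1 ∈ t.1 ∧ t.2.2 ∈ t.1 ∧ t.2.1 - t.2.2 = d} := by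
  refine (Nat.card_congr (((Equiv.Set.congr f.toEquiv).prodCongr
    (f.toEquiv.prodCongr f.toEquiv)).subtypeEquiv fun t => ?_)).symm
  change (t.1 ∈ Bs ∧ t.2.1 ∈ t.1 ∧ t.2.2 ∈ t.1 ∧ t.2.1 - t.2.2 = d) ↔
    (f '' t.1 ∈ Bs ∧ f t.2.1 ∈ f '' t.1 ∧ f t.2.2 ∈ f '' t.1 ∧ f t.2.1 - f t.2.2 = f d)
  rw [hf, f.injective.mem_set_image, f.injective.mem_set_image, ← map_sub, f.injective.eq_iff]

/-- Right multiplication by a nonzero element, as an additive automorphism. -/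
def mulRightAddEquiv {F : Type*} [Field F] (x : F) (hx : x ≠ 0) : F ≃+ F where
  toEquiv := Equiv.mulRight₀ x hx
  map_add' a b := add_mul a b x

/-- Corollary 8 (for fields): let `F` be a finite field and `S ⊆ F` with `|S| > 1`.
Then `Bs = {S·x | x ∈ F*}` is a short difference family in the additive group `(F,+)`. -/
theorem sdf_of_finite_field {F : Type*} [Field F] [Finite F] (S : Set F)
    (hcard : 1 < Nat.card S) :
    ∃ (k : ℕ) (lam : ℚ),
      IsSDF {B : Set F | ∃ x : F, x ≠ 0 ∧ B = (fun s => s * x) '' S}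
        (Nat.card F) k lam := by
  set Bs : Set (Set F) := {B : Set F | ∃ x : F, x ≠ 0 ∧ B = (fun s => s * x) '' S}
  have hinv (x : F) (hx : x ≠ 0) (C : Set F) : mulRightAddEquiv x hx '' C ∈ Bs ↔ C ∈ Bs := by
    change (fun s => s * x) '' C ∈ Bs ↔ C ∈ Bs
    constructor
    · rintro ⟨y, hy, h⟩
      refine ⟨y * x⁻¹, mul_ne_zero hy (inv_ne_zero hx), ?_⟩
      have h' := congrArg (fun D : Set F => (fun s => s * x⁻¹) '' D) h
      simpa [Set.image_image, mul_assoc, hx] using h'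
    · rintro ⟨y, hy, rfl⟩
      exact ⟨y * x, mul_ne_zero hy hx, by simp [Set.image_image, mul_assoc]⟩
  obtain ⟨⟨a, ha⟩, ⟨b, hb⟩, hab⟩ := (Finite.one_lt_card_iff_nontrivial.mp hcard).exists_pair_ne
  have hab' : a - b ≠ 0 := sub_ne_zero.mpr fun h => hab (Subtype.ext h)
  refine ⟨Nat.card S, _, rfl, Finite.one_lt_card, by omega, ?_,
    Nat.card (rtStab S),
    Nat.card {C : Set F | C ∈ Bs ∧ ∃ g : F, S = (fun x => x + g) '' C},
    Nat.card {t : Set F × F × F |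
      t.1 ∈ Bs ∧ t.2.1 ∈ t.1 ∧ t.2.2 ∈ t.1 ∧ t.2.1 - t.2.2 = 1},
    ?_, ?_, ?_, rfl, ?_, ?_, ?_⟩
  · rintro _ ⟨x, hx, rfl⟩
    exact Nat.card_image_of_injective (mul_left_injective₀ hx) S
  · have : Nonempty (rtStab S) := ⟨0, by simp [rtStab]⟩
    exact Nat.card_pos
  · have : Nonempty {C : Set F | C ∈ Bs ∧ ∃ g : F, S = (fun x => x + g) '' C} :=
      ⟨S, ⟨1, one_ne_zero, by simp⟩, 0, by simp⟩
    exact Nat.card_pos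
  · have : Nonempty {t : Set F × F × F |
        t.1 ∈ Bs ∧ t.2.1 ∈ t.1 ∧ t.2.2 ∈ t.1 ∧ t.2.1 - t.2.2 = 1} :=
      ⟨((fun s => s * (a - b)⁻¹) '' S, a * (a - b)⁻¹, b * (a - b)⁻¹),
        ⟨(a - b)⁻¹, inv_ne_zero hab', rfl⟩, ⟨a, ha, rfl⟩, ⟨b, hb, rfl⟩,
        by simp only [← sub_mul, mul_inv_cancel₀ hab']⟩
    exact Nat.card_pos
  · rintro _ ⟨x, hx, rfl⟩
    exact card_rtStab_image (mulRightAddEquiv x hx) S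
  · rintro _ ⟨x, hx, rfl⟩
    exact card_translationClass_image (mulRightAddEquiv x hx) Bs (hinv x hx) S
  · intro d hd
    have h := card_differences_map (mulRightAddEquiv d hd) Bs (hinv d hd) 1
    rwa [show mulRightAddEquiv d hd 1 = d from one_mul d] at h
end

section
/- Let α be an automorphism of a group (G,+) such that the map 𝟏−α : x ↦ x − α(x) is also an automorphism of (G,+). Then (G,+) is abelian. -/
variable {G : Type*}

/-- Lemma 10: let `α` be an automorphism of a group `(G,+)` such that the map
`𝟏 - α : x ↦ x - α(x)` is also an automorphism of `(G,+)`.  Then `(G,+)` is abelian. -/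
theorem abelian_of_one_sub_aut [AddGroup G] (α : AddAut G)
    (h : ∃ β : AddAut G, ∀ x : G, β x = x - α x) :
    ∀ x y : G, x + y = y + x := by
  obtain ⟨β, hβ⟩ := h
  intro x y
  obtain ⟨u, rfl⟩ := AddEquiv.surjective β x
  obtain ⟨v, hv⟩ := AddEquiv.surjective α (-y)
  have key := map_add β v u
  simp only [hβ, map_add, hv, sub_eq_add_neg, neg_add_rev, neg_neg, add_assoc,
    add_right_inj] at key
  simpa only [hβ, sub_eq_add_neg, add_assoc] using key
end

section
/- Let (G,+) be a finite abelian group and S a set of endomorphisms of G with 𝟎, 𝟏 ∈ S and {𝟏−α | α ∈ S} = S (so that S(x) = x − S(x) for all x ∈ G*). If a, b ∈ G* and c ∈ G satisfy S(a) = S(b)+c, then −a+b+2c ∈ G_{S(a)}, i.e., S(a) + (−a+b+2c) = S(a). -/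
variable {G : Type*}

/-- `S(a) = {σ(a) | σ ∈ S}` for a set `S` of maps on `G`. -/
def appSet (S : Set (G → G)) (a : G) : Set G := (fun f => f a) '' S

theorem mem_appSet_sub_iff [AddCommGroup G] {S : Set (G → G)}
    (hsym : {f : G → G | ∃ α ∈ S, f = fun x => x - α x} = S) (x y : G) :
    x - y ∈ appSet S x ↔ y ∈ appSet S x := by
  have key : ∀ z, z ∈ appSet S x → x - z ∈ appSet S x := by
    rintro _ ⟨f, hf, rfl⟩
    exact ⟨fun x => x - f x, hsym ▸ ⟨f, hf, rfl⟩, rfl⟩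
  exact ⟨fun hy => by simpa using key _ hy, key y⟩

/-- Lemma 14: let `(G,+)` be a finite abelian group and `S` a set of endomorphisms of
`G` with `𝟎, 𝟏 ∈ S` and `{𝟏-α | α ∈ S} = S` (so that `S(x) = x - S(x)` for `x ≠ 0`).
If `a, b ∈ G*` and `c ∈ G` satisfy `S(a) = S(b) + c`, then `-a + b + 2c` lies in the
stabilizer `G_{S(a)}`, i.e. `S(a) + (-a + b + 2c) = S(a)`. -/
theorem segments_stab_element [AddCommGroup G] [Finite G] [Nontrivial G]
    (S : Set (G → G))
    (hend : ∀ f ∈ S, ∀ x y : G, f (x + y) = f x + f y)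
    (h0 : (0 : G → G) ∈ S) (h1 : (id : G → G) ∈ S)
    (hsym : {f : G → G | ∃ α ∈ S, f = fun x => x - α x} = S)
    (a b : G) (ha : a ≠ 0) (hb : b ≠ 0) (c : G)
    (h : appSet S a = (fun x => x + c) '' appSet S b) :
    (fun x => x + (-a + b + (c + c))) '' appSet S a = appSet S a := by
  have hshift : ∀ y, y ∈ appSet S a ↔ y - c ∈ appSet S b := by
    intro y
    rw [h]
    simp [← sub_eq_add_neg]
  have hstab : ∀ y, y ∈ appSet S a ↔ y + (-a + b + (c + c)) ∈ appSet S a := by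
    intro y
    rw [← mem_appSet_sub_iff hsym a y, hshift, ← mem_appSet_sub_iff hsym b, hshift]
    have hy : b - (a - y - c) = y + (-a + b + (c + c)) - c := by abel
    rw [hy]
  ext y
  constructor
  · rintro ⟨z, hz, rfl⟩
    exact (hstab z).1 hz
  · intro hy
    exact ⟨y - (-a + b + (c + c)), (hstab _).2 (by simpa using hy), sub_add_cancel _ _⟩
end
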